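/- arXiv:2202.04156 — 2 statements merged into one kernel-verified Lean document; each statement's English description precedes it below -/
import Mathlib

section
/- For every real 2×2 matrix A with det A = 1 (i.e. A ∈ SL(2,ℝ)), the number p(A·ℤ², L) of pairs (m,n) ∈ ℤ × ℤ with gcd(m,n) = 1 and ‖A·(m,n)‖ ≤ L (Euclidean norm of the image vector) satisfies lim_{L→∞} p(A·ℤ², L)/L² = 6/π. -/
open Filter

/-- The Euclidean norm of the image of the integer vector `v ∈ ℤ²` under the linear map
given by the real matrix `A`. -/
noncomputable def latticeImageNorm (A : Matrix (Fin 2) (Fin 2) ℝ) (v : ℤ × ℤ) : ℝ :=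
  Real.sqrt ((A 0 0 * (v.1 : ℝ) + A 0 1 * (v.2 : ℝ)) ^ 2
    + (A 1 0 * (v.1 : ℝ) + A 1 1 * (v.2 : ℝ)) ^ 2)

open MeasureTheory ArithmeticFunction
open scoped ArithmeticFunction.Moebius Pointwise

/-- The sum of the absolute values of the entries of a `2 × 2` matrix. -/
noncomputable def entryAbsSum (A : Matrix (Fin 2) (Fin 2) ℝ) : ℝ :=
  |A 0 0| + |A 0 1| + |A 1 0| + |A 1 1|

theorem abs_le_entryAbsSum_mul_sqrt {A : Matrix (Fin 2) (Fin 2) ℝ} (hA : A.det = 1) (x y : ℝ) :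
    |x| ≤ entryAbsSum A *
        Real.sqrt ((A 0 0 * x + A 0 1 * y) ^ 2 + (A 1 0 * x + A 1 1 * y) ^ 2) ∧
      |y| ≤ entryAbsSum A *
        Real.sqrt ((A 0 0 * x + A 0 1 * y) ^ 2 + (A 1 0 * x + A 1 1 * y) ^ 2) := by
  rw [Matrix.det_fin_two] at hA
  set u := A 0 0 * x + A 0 1 * y with hu
  set w := A 1 0 * x + A 1 1 * y with hw
  have hx : x = A 1 1 * u - A 0 1 * w := by
    linear_combination (-x) * hA + A 1 1 * hu - A 0 1 * hw
  have hy : y = A 0 0 * w - A 1 0 * u := by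
    linear_combination (-y) * hA + A 0 0 * hw - A 1 0 * hu
  have hu' : |u| ≤ Real.sqrt (u ^ 2 + w ^ 2) := Real.abs_le_sqrt (by nlinarith [sq_nonneg w])
  have hw' : |w| ≤ Real.sqrt (u ^ 2 + w ^ 2) := Real.abs_le_sqrt (by nlinarith [sq_nonneg u])
  set r := Real.sqrt (u ^ 2 + w ^ 2)
  have hr : 0 ≤ r := Real.sqrt_nonneg _
  have key (p q : ℝ) : |p * u - q * w| ≤ (|p| + |q|) * r := by
    calc |p * u - q * w| ≤ |p * u| + |q * w| := abs_sub _ _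
      _ = |p| * |u| + |q| * |w| := by rw [abs_mul, abs_mul]
      _ ≤ |p| * r + |q| * r := by gcongr
      _ = _ := by ring
  have h₀ := abs_nonneg (A 0 0)
  have h₁ := abs_nonneg (A 0 1)
  have h₂ := abs_nonneg (A 1 0)
  have h₃ := abs_nonneg (A 1 1)
  constructor
  · calc |x| = |A 1 1 * u - A 0 1 * w| := by rw [← hx]
      _ ≤ (|A 1 1| + |A 0 1|) * r := key _ _
      _ ≤ entryAbsSum A * r := mul_le_mul_of_nonneg_right (by unfold entryAbsSum; linarith) hr
  · calc |y| = |A 1 0 * u - A 0 0 * w| := by rw [abs_sub_comm, ← hy]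
      _ ≤ (|A 1 0| + |A 0 0|) * r := key _ _
      _ ≤ entryAbsSum A * r := mul_le_mul_of_nonneg_right (by unfold entryAbsSum; linarith) hr

theorem abs_le_entryAbsSum_mul_latticeImageNorm {A : Matrix (Fin 2) (Fin 2) ℝ} (hA : A.det = 1)
    (v : ℤ × ℤ) :
    |(v.1 : ℝ)| ≤ entryAbsSum A * latticeImageNorm A v ∧
      |(v.2 : ℝ)| ≤ entryAbsSum A * latticeImageNorm A v :=
  abs_le_entryAbsSum_mul_sqrt hA _ _

theorem entryAbsSum_nonneg (A : Matrix (Fin 2) (Fin 2) ℝ) : 0 ≤ entryAbsSum A := by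
  unfold entryAbsSum; positivity

theorem latticeImageNorm_natCast_mul (A : Matrix (Fin 2) (Fin 2) ℝ) (d : ℕ) (v : ℤ × ℤ) :
    latticeImageNorm A (d * v.1, d * v.2) = d * latticeImageNorm A v := by
  unfold latticeImageNorm
  rw [← Real.sqrt_sq (Nat.cast_nonneg (α := ℝ) d), ← Real.sqrt_mul (sq_nonneg _)]
  congr 1
  push_cast
  ring

theorem setOf_latticeImageNorm_le_subset {A : Matrix (Fin 2) (Fin 2) ℝ} (hA : A.det = 1) (L : ℝ) :
    {v | latticeImageNorm A v ≤ L} ⊆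
      (Finset.Icc (-⌊entryAbsSum A * L⌋) ⌊entryAbsSum A * L⌋ ×ˢ
        Finset.Icc (-⌊entryAbsSum A * L⌋) ⌊entryAbsSum A * L⌋ : Finset (ℤ × ℤ)) := by
  intro v hv
  obtain ⟨h₁, h₂⟩ := abs_le_entryAbsSum_mul_latticeImageNorm hA v
  have h₃ : entryAbsSum A * latticeImageNorm A v ≤ entryAbsSum A * L :=
    mul_le_mul_of_nonneg_left hv (entryAbsSum_nonneg A)
  have h₁' : |v.1| ≤ ⌊entryAbsSum A * L⌋ := Int.le_floor.2 (by push_cast; linarith)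
  have h₂' : |v.2| ≤ ⌊entryAbsSum A * L⌋ := Int.le_floor.2 (by push_cast; linarith)
  rw [abs_le] at h₁' h₂'
  simpa using ⟨⟨h₁'.1, h₂'.1⟩, h₁'.2, h₂'.2⟩

theorem finite_setOf_latticeImageNorm_le {A : Matrix (Fin 2) (Fin 2) ℝ} (hA : A.det = 1) (L : ℝ) :
    {v | latticeImageNorm A v ≤ L}.Finite :=
  (Finset.finite_toSet _).subset (setOf_latticeImageNorm_le_subset hA L)

theorem latticeImageNorm_zero (A : Matrix (Fin 2) (Fin 2) ℝ) : latticeImageNorm A 0 = 0 := by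
  simp [latticeImageNorm]

theorem ncard_ne_zero_latticeImageNorm_le {A : Matrix (Fin 2) (Fin 2) ℝ} (hA : A.det = 1)
    {L : ℝ} (hL : 0 ≤ L) :
    ({v | v ≠ 0 ∧ latticeImageNorm A v ≤ L}.ncard : ℝ) =
      {v | latticeImageNorm A v ≤ L}.ncard - 1 := by
  have h : {v | v ≠ 0 ∧ latticeImageNorm A v ≤ L} = {v | latticeImageNorm A v ≤ L} \ {0} := by
    ext v; simp [and_comm]
  rw [h, eq_sub_iff_add_eq]
  exact_mod_cast Set.ncard_sdiff_singleton_add_one (by simpa [latticeImageNorm_zero] using hL)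
    (finite_setOf_latticeImageNorm_le hA L)

theorem ncard_ne_zero_latticeImageNorm_le_le {A : Matrix (Fin 2) (Fin 2) ℝ} (hA : A.det = 1)
    (L : ℝ) :
    ({v | v ≠ 0 ∧ latticeImageNorm A v ≤ L}.ncard : ℝ) ≤ 9 * entryAbsSum A ^ 2 * L ^ 2 := by
  rcases Set.eq_empty_or_nonempty {v | v ≠ 0 ∧ latticeImageNorm A v ≤ L} with h | ⟨v, hv, hvL⟩
  · rw [h, Set.ncard_empty, Nat.cast_zero]
    positivity
  have hsub := setOf_latticeImageNorm_le_subset hA L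
  obtain ⟨h₁, h₂⟩ := abs_le_entryAbsSum_mul_latticeImageNorm hA v
  have h₃ : entryAbsSum A * latticeImageNorm A v ≤ entryAbsSum A * L :=
    mul_le_mul_of_nonneg_left hvL (entryAbsSum_nonneg A)
  have hKL : 1 ≤ entryAbsSum A * L := by
    have : v.1 ≠ 0 ∨ v.2 ≠ 0 := by
      by_contra! h
      exact hv (Prod.ext h.1 h.2)
    rcases this with h | h
    · have : (1 : ℝ) ≤ |(v.1 : ℝ)| := by exact_mod_cast Int.one_le_abs h
      linarith
    · have : (1 : ℝ) ≤ |(v.2 : ℝ)| := by exact_mod_cast Int.one_le_abs h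
      linarith
  set n := ⌊entryAbsSum A * L⌋ with hn
  have hn0 : 0 ≤ n := Int.floor_nonneg.2 (by linarith)
  have hnle : (n : ℝ) ≤ entryAbsSum A * L := Int.floor_le _
  have hcard : {v | v ≠ 0 ∧ latticeImageNorm A v ≤ L}.ncard ≤ (2 * n + 1).toNat ^ 2 := by
    refine (Set.ncard_le_ncard (fun v hv => hsub hv.2) (Finset.finite_toSet _)).trans ?_
    rw [Set.ncard_coe_finset, Finset.card_product, Int.card_Icc, sq,
      show n + 1 - -n = 2 * n + 1 by ring]
  have hcast : (((2 * n + 1).toNat : ℕ) : ℝ) = 2 * n + 1 := by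
    have : (((2 * n + 1).toNat : ℕ) : ℤ) = 2 * n + 1 := Int.toNat_of_nonneg (by omega)
    exact_mod_cast this
  have hn0' : (0 : ℝ) ≤ n := by exact_mod_cast hn0
  calc ({v | v ≠ 0 ∧ latticeImageNorm A v ≤ L}.ncard : ℝ)
      ≤ (((2 * n + 1).toNat : ℕ) : ℝ) ^ 2 := by exact_mod_cast hcard
    _ = (2 * n + 1) ^ 2 := by rw [hcast]
    _ ≤ (3 * (entryAbsSum A * L)) ^ 2 := by gcongr; linarith
    _ = _ := by ring

theorem tsum_moebius_div_sq :
    ∑' n : ℕ, (μ n : ℝ) / (n : ℝ) ^ 2 = 6 / Real.pi ^ 2 := by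
  have h := LSeries_zeta_mul_Lseries_moebius (s := 2) (by norm_num)
  rw [LSeries_zeta_eq_riemannZeta (by norm_num), riemannZeta_two] at h
  have hL : LSeries (fun n => ((μ n : ℤ) : ℂ)) 2
      = ((∑' n : ℕ, (μ n : ℝ) / (n : ℝ) ^ 2 : ℝ) : ℂ) := by
    rw [LSeries, Complex.ofReal_tsum]
    refine tsum_congr fun n => ?_
    rcases eq_or_ne n 0 with rfl | hn
    · simp
    · rw [LSeries.term_of_ne_zero hn]
      push_cast
      norm_cast
  rw [hL] at h
  have h' : Real.pi ^ 2 / 6 * (∑' n : ℕ, (μ n : ℝ) / (n : ℝ) ^ 2) = 1 := by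
    exact_mod_cast h
  have := Real.pi_pos
  field_simp at h' ⊢
  linarith

theorem hasSum_moebius_ite_dvd {n : ℕ} (hn : n ≠ 0) :
    HasSum (fun d : ℕ => if d ∣ n then (μ d : ℝ) else 0) (if n = 1 then 1 else 0) := by
  have h : ∑ d ∈ n.divisors, (if d ∣ n then (μ d : ℝ) else 0) = if n = 1 then 1 else 0 := by
    rw [Finset.sum_congr rfl fun d hd => if_pos (Nat.dvd_of_mem_divisors hd)]
    have : ∑ d ∈ n.divisors, μ d = if n = 1 then 1 else 0 := by
      rw [← coe_mul_zeta_apply, moebius_mul_coe_zeta, one_apply]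
    exact_mod_cast this
  rw [← h]
  exact hasSum_sum_of_ne_finset_zero fun d hd => if_neg fun hdn =>
    hd (Nat.mem_divisors.2 ⟨hdn, hn⟩)

theorem ncard_latticeImageNorm_le_div {A : Matrix (Fin 2) (Fin 2) ℝ} {d : ℕ} (hd : d ≠ 0) (L : ℝ) :
    {v | v ≠ 0 ∧ latticeImageNorm A v ≤ L / d}.ncard =
      {v | (v ≠ 0 ∧ latticeImageNorm A v ≤ L) ∧ d ∣ Int.gcd v.1 v.2}.ncard := by
  have hd' : (0 : ℝ) < d := by exact_mod_cast Nat.pos_of_ne_zero hd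
  have hdz : (d : ℤ) ≠ 0 := by exact_mod_cast hd
  refine Set.ncard_congr (fun v _ => (d * v.1, d * v.2)) ?_ ?_ ?_
  · rintro v ⟨hv, hvL⟩
    refine ⟨⟨?_, ?_⟩, ?_⟩
    · intro h
      simp only [Prod.mk_eq_zero, mul_eq_zero, hdz, false_or] at h
      exact hv (Prod.ext h.1 h.2)
    · rw [latticeImageNorm_natCast_mul]
      rwa [le_div_iff₀' hd'] at hvL
    · exact Int.dvd_gcd (Dvd.intro _ rfl) (Dvd.intro _ rfl)
  · intro v w _ _ h
    simp only [Prod.mk.injEq, mul_eq_mul_left_iff, hdz, or_false] at h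
    exact Prod.ext h.1 h.2
  · rintro ⟨m, n⟩ ⟨⟨hv, hvL⟩, hdvd⟩
    obtain ⟨a, rfl⟩ : (d : ℤ) ∣ m := (Int.natCast_dvd_natCast.2 hdvd).trans (Int.gcd_dvd_left ..)
    obtain ⟨b, rfl⟩ : (d : ℤ) ∣ n := (Int.natCast_dvd_natCast.2 hdvd).trans (Int.gcd_dvd_right ..)
    refine ⟨(a, b), ⟨?_, ?_⟩, rfl⟩
    · intro h
      simp only [Prod.mk_eq_zero] at h
      simp [h.1, h.2] at hv
    · rw [le_div_iff₀' hd', ← latticeImageNorm_natCast_mul]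
      exact hvL

theorem card_primitive_eq_tsum {A : Matrix (Fin 2) (Fin 2) ℝ} (hA : A.det = 1) (L : ℝ) :
    (Nat.card {v : ℤ × ℤ // Int.gcd v.1 v.2 = 1 ∧ latticeImageNorm A v ≤ L} : ℝ) =
      ∑' d : ℕ, (μ d : ℝ) * {v | v ≠ 0 ∧ latticeImageNorm A v ≤ L / d}.ncard := by
  have hfin : {v | v ≠ 0 ∧ latticeImageNorm A v ≤ L}.Finite :=
    (finite_setOf_latticeImageNorm_le hA L).subset fun v hv => hv.2
  have hgcd {v : ℤ × ℤ} (hv : v ∈ hfin.toFinset) : Int.gcd v.1 v.2 ≠ 0 := by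
    rw [Ne, Int.gcd_eq_zero_iff]
    exact fun h => ((hfin.mem_toFinset).1 hv).1 (Prod.ext h.1 h.2)
  have hterm (d : ℕ) : (μ d : ℝ) * {v | v ≠ 0 ∧ latticeImageNorm A v ≤ L / d}.ncard =
      ∑ v ∈ hfin.toFinset, if d ∣ Int.gcd v.1 v.2 then (μ d : ℝ) else 0 := by
    rcases eq_or_ne d 0 with rfl | hd
    · simp
    rw [ncard_latticeImageNorm_le_div hd, ← Finset.sum_filter, Finset.sum_const, nsmul_eq_mul,
      mul_comm, ← Set.ncard_coe_finset]
    congr 3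
    ext v
    simp
  simp_rw [hterm]
  rw [Summable.tsum_finsetSum fun v hv => (hasSum_moebius_ite_dvd (hgcd hv)).summable,
    Finset.sum_congr rfl fun v hv => (hasSum_moebius_ite_dvd (hgcd hv)).tsum_eq,
    ← Finset.sum_filter, Finset.sum_const, nsmul_eq_mul, mul_one, ← Set.ncard_coe_finset]
  congr 1
  change Set.ncard _ = _
  congr 1
  ext v
  simp only [Finset.coe_filter, Set.Finite.mem_toFinset, Set.mem_ofPred_eq]
  constructor
  · rintro ⟨h, h'⟩
    refine ⟨⟨?_, h'⟩, h⟩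
    rintro rfl
    simp at h
  · rintro ⟨⟨_, h'⟩, h⟩
    exact ⟨h, h'⟩

/-- The filled ellipse of vectors whose image under `A` has Euclidean norm at most one. -/
def imageUnitDisc (A : Matrix (Fin 2) (Fin 2) ℝ) : Set (Fin 2 → ℝ) :=
  {x | Real.sqrt ((A 0 0 * x 0 + A 0 1 * x 1) ^ 2 + (A 1 0 * x 0 + A 1 1 * x 1) ^ 2) ≤ 1}

theorem imageUnitDisc_eq_preimage (A : Matrix (Fin 2) (Fin 2) ℝ) :
    imageUnitDisc A = Matrix.toLin' A ⁻¹'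
      (WithLp.toLp 2 ⁻¹' Metric.closedBall (0 : EuclideanSpace ℝ (Fin 2)) 1) := by
  ext x
  simp [imageUnitDisc, EuclideanSpace.norm_eq, Fin.sum_univ_two]

theorem volume_real_imageUnitDisc {A : Matrix (Fin 2) (Fin 2) ℝ} (hA : A.det = 1) :
    volume.real (imageUnitDisc A) = Real.pi := by
  rw [imageUnitDisc_eq_preimage, measureReal_def,
    Measure.addHaar_preimage_linearMap _ (by simp [hA]),
    (PiLp.volume_preserving_toLp (Fin 2)).measure_preimage
      measurableSet_closedBall.nullMeasurableSet]
  simp [hA, Real.pi_nonneg]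

theorem convex_imageUnitDisc (A : Matrix (Fin 2) (Fin 2) ℝ) : Convex ℝ (imageUnitDisc A) := by
  rw [imageUnitDisc_eq_preimage]
  exact ((convex_closedBall _ _).linear_preimage
    (WithLp.linearEquiv 2 ℝ (Fin 2 → ℝ)).symm.toLinearMap).linear_preimage (Matrix.toLin' A)

theorem isClosed_imageUnitDisc (A : Matrix (Fin 2) (Fin 2) ℝ) : IsClosed (imageUnitDisc A) :=
  isClosed_le (by fun_prop) continuous_const

theorem isBounded_imageUnitDisc {A : Matrix (Fin 2) (Fin 2) ℝ} (hA : A.det = 1) :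
    Bornology.IsBounded (imageUnitDisc A) := by
  refine (Metric.isBounded_closedBall (x := (0 : Fin 2 → ℝ)) (r := entryAbsSum A)).subset ?_
  intro x hx
  obtain ⟨h₀, h₁⟩ := abs_le_entryAbsSum_mul_sqrt hA (x 0) (x 1)
  have h := mul_le_of_le_one_right (entryAbsSum_nonneg A) hx
  rw [mem_closedBall_zero_iff, pi_norm_le_iff_of_nonneg (entryAbsSum_nonneg A), Fin.forall_fin_two]
  exact ⟨h₀.trans h, h₁.trans h⟩

theorem zero_mem_imageUnitDisc (A : Matrix (Fin 2) (Fin 2) ℝ) : 0 ∈ imageUnitDisc A := by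
  simp [imageUnitDisc]

theorem natCard_imageUnitDisc_inter (A : Matrix (Fin 2) (Fin 2) ℝ) {L : ℝ} (hL : 0 < L) :
    Nat.card (imageUnitDisc A ∩
        L⁻¹ • (Submodule.span ℤ (Set.range (Pi.basisFun ℝ (Fin 2))) : Set (Fin 2 → ℝ)) : Set _) =
      {v | latticeImageNorm A v ≤ L}.ncard := by
  symm
  change _ = Set.ncard _
  have hmem (v : ℤ × ℤ) : (![L⁻¹ * v.1, L⁻¹ * v.2] : Fin 2 → ℝ) ∈ imageUnitDisc A ↔
      latticeImageNorm A v ≤ L := by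
    have : Real.sqrt ((A 0 0 * (L⁻¹ * v.1) + A 0 1 * (L⁻¹ * v.2)) ^ 2 +
        (A 1 0 * (L⁻¹ * v.1) + A 1 1 * (L⁻¹ * v.2)) ^ 2) = latticeImageNorm A v / L := by
      rw [latticeImageNorm, ← Real.sqrt_sq hL.le, ← Real.sqrt_div' _ (sq_nonneg _),
        Real.sqrt_sq hL.le]
      congr 1
      field_simp
    simp only [imageUnitDisc, Set.mem_ofPred_eq, Matrix.cons_val_zero, Matrix.cons_val_one, this]
    rw [div_le_one hL]
  refine Set.ncard_congr (fun v _ => ![L⁻¹ * v.1, L⁻¹ * v.2]) ?_ ?_ ?_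
  · intro v hv
    refine ⟨(hmem v).2 hv, ?_⟩
    rw [Set.mem_inv_smul_set_iff₀ hL.ne', SetLike.mem_coe, Module.Basis.mem_span_iff_repr_mem,
      Fin.forall_fin_two]
    exact ⟨⟨v.1, by simp [hL.ne']⟩, ⟨v.2, by simp [hL.ne']⟩⟩
  · intro v w _ _ h
    have h₀ := congrFun h 0
    have h₁ := congrFun h 1
    simp only [Matrix.cons_val_zero, Matrix.cons_val_one, mul_eq_mul_left_iff, Int.cast_inj,
      inv_eq_zero, hL.ne', or_false] at h₀ h₁
    exact Prod.ext h₀ h₁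
  · rintro x ⟨hx, hxL⟩
    rw [Set.mem_inv_smul_set_iff₀ hL.ne', SetLike.mem_coe, Module.Basis.mem_span_iff_repr_mem,
      Fin.forall_fin_two] at hxL
    obtain ⟨⟨m, hm⟩, ⟨n, hn⟩⟩ := hxL
    have hx' : (![L⁻¹ * m, L⁻¹ * n] : Fin 2 → ℝ) = x := by
      simp only [algebraMap_int_eq, eq_intCast, Pi.basisFun_repr, Pi.smul_apply,
        smul_eq_mul] at hm hn
      ext i
      fin_cases i
      · simp [hm, hL.ne']
      · simp [hn, hL.ne']
    exact ⟨(m, n), (hmem (m, n)).1 (by rwa [hx']), hx'⟩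

theorem tendsto_ncard_latticeImageNorm_le_div_sq {A : Matrix (Fin 2) (Fin 2) ℝ}
    (hA : A.det = 1) :
    Tendsto (fun L : ℝ => ({v | v ≠ 0 ∧ latticeImageNorm A v ≤ L}.ncard : ℝ) / L ^ 2)
      atTop (nhds Real.pi) := by
  have h := tendsto_card_div_pow_atTop_volume' (imageUnitDisc A) (isBounded_imageUnitDisc hA)
    (isClosed_imageUnitDisc A).measurableSet ((convex_imageUnitDisc A).addHaar_frontier _)
    fun x y hx hxy => by
      rw [Set.smul_set_subset_iff₀ hx.ne', smul_smul]
      intro z hz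
      have hy : 0 < y := hx.trans_le hxy
      rw [Set.mem_smul_set_iff_inv_smul_mem₀ (by positivity)]
      refine (convex_imageUnitDisc A).smul_mem_of_zero_mem (zero_mem_imageUnitDisc A) hz ?_
      rw [mul_inv, inv_inv, ← div_eq_mul_inv]
      exact ⟨by positivity, (div_le_one hy).2 hxy⟩
  rw [volume_real_imageUnitDisc hA, Fintype.card_fin] at h
  have h₂ : Tendsto (fun L : ℝ => (L ^ 2)⁻¹) atTop (nhds 0) :=
    (tendsto_pow_atTop two_ne_zero).inv_tendsto_atTop
  refine (sub_zero Real.pi ▸ h.sub h₂).congr' ?_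
  filter_upwards [eventually_gt_atTop 0] with L hL
  rw [natCard_imageUnitDisc_inter A hL, ncard_ne_zero_latticeImageNorm_le hA hL.le, sub_div,
    one_div]

/-- **Counting primitive points of unimodular lattices.** For every `A ∈ SL(2,ℝ)`, the number
of primitive integer vectors `(m,n)` with `‖A·(m,n)‖ ≤ L` is asymptotic to `(6/π) · L²`. -/
theorem primitive_lattice_point_count_unimodular
    (A : Matrix (Fin 2) (Fin 2) ℝ) (hA : A.det = 1) :
    Tendsto (fun L : ℝ =>
      (Nat.card {v : ℤ × ℤ // Int.gcd v.1 v.2 = 1 ∧ latticeImageNorm A v ≤ L} : ℝ) / L ^ 2)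
      atTop (nhds (6 / Real.pi)) := by
  simp_rw [card_primitive_eq_tsum hA, ← tsum_div_const]
  have hlim : 6 / Real.pi = ∑' d : ℕ, (μ d : ℝ) / (d : ℝ) ^ 2 * Real.pi := by
    rw [tsum_mul_right, tsum_moebius_div_sq]
    have := Real.pi_pos
    field_simp
  rw [hlim]
  refine tendsto_tsum_of_dominated_convergence
    (bound := fun d : ℕ => 9 * entryAbsSum A ^ 2 * ((d : ℝ) ^ 2)⁻¹)
    ((Real.summable_nat_pow_inv.2 one_lt_two).mul_left _) (fun d => ?_) ?_
  · rcases eq_or_ne d 0 with rfl | hd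
    · simp
    have hd' : (0 : ℝ) < d := by exact_mod_cast Nat.pos_of_ne_zero hd
    refine (((tendsto_ncard_latticeImageNorm_le_div_sq hA).comp
      (tendsto_id.atTop_div_const hd')).const_mul ((μ d : ℝ) / (d : ℝ) ^ 2)).congr fun L => ?_
    simp only [Function.comp_apply, id_eq]
    field_simp
  · filter_upwards [eventually_gt_atTop 0] with L hL d
    have hμ : |(μ d : ℝ)| ≤ 1 := by exact_mod_cast abs_moebius_le_one (n := d)
    rw [Real.norm_eq_abs, abs_div, abs_mul, Nat.abs_cast, abs_of_pos (by positivity : 0 < L ^ 2),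
      div_le_iff₀ (by positivity)]
    calc |(μ d : ℝ)| * ({v | v ≠ 0 ∧ latticeImageNorm A v ≤ L / d}.ncard : ℝ)
        ≤ 1 * (9 * entryAbsSum A ^ 2 * (L / d) ^ 2) := by
          gcongr
          exact ncard_ne_zero_latticeImageNorm_le_le hA _
      _ = 9 * entryAbsSum A ^ 2 * ((d : ℝ) ^ 2)⁻¹ * L ^ 2 := by
          rw [div_pow]
          ring
end

section
/- Let (L_k)_{k∈ℕ} be a sequence of positive reals tending to ∞, and let μ' be a locally finite Borel measure on ℝ² such that for every continuous compactly supported f : ℝ² → ℝ one has (1/L_k²) · Σ_{(a,b) ∈ ℤ², gcd(a,b)=1} f(a/L_k, b/L_k) → ∫_{ℝ²} f dμ' as k → ∞. Then there exists a constant c ≥ 0 such that μ' = c · λ, where λ is the Lebesgue measure on ℝ². -/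
open Filter MeasureTheory
open scoped NNReal

lemma map_floor_prod_volume :
    Measure.map (fun x : ℝ × ℝ => (⌊x.1⌋, ⌊x.2⌋)) volume = Measure.count := by
  have hm : Measurable (fun x : ℝ × ℝ => (⌊x.1⌋, ⌊x.2⌋)) := by fun_prop
  refine Measure.ext_of_singleton fun v => ?_
  have hpre : (fun x : ℝ × ℝ => (⌊x.1⌋, ⌊x.2⌋)) ⁻¹' {v} =
      Set.Ico (v.1 : ℝ) (v.1 + 1) ×ˢ Set.Ico (v.2 : ℝ) (v.2 + 1) := by
    ext x
    simp [Prod.ext_iff, Int.floor_eq_iff]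
  rw [Measure.map_apply hm (measurableSet_singleton v), hpre, Measure.volume_eq_prod,
    Measure.prod_prod]
  simp

lemma integral_comp_floor_prod {g : ℤ × ℤ → ℝ} (hg : g.support.Finite) :
    ∫ x : ℝ × ℝ, g (⌊x.1⌋, ⌊x.2⌋) = ∑' v, g v := by
  have hm : Measurable (fun x : ℝ × ℝ => (⌊x.1⌋, ⌊x.2⌋)) := by fun_prop
  have hint : Integrable g Measure.count := by
    rw [integrable_count_iff]
    exact (summable_of_hasFiniteSupport hg).norm
  rw [← integral_map (f := g) hm.aemeasurable .of_discrete, map_floor_prod_volume,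
    integral_countable hint]
  simp [Measure.real]

open ArithmeticFunction in
lemma sum_divisors_moebius (n : ℕ) :
    ∑ d ∈ n.divisors, (moebius d : ℝ) = if n = 1 then 1 else 0 := by
  rw [← one_apply, ← coe_moebius_mul_coe_zeta (R := ℝ), coe_mul_zeta_apply]
  simp

/-- Möbius inversion for sums over primitive vectors of `ℤ²`. -/
lemma tsum_primitive_eq_tsum_moebius {g : ℤ × ℤ → ℝ} (hg : g.support.Finite) (h0 : g 0 = 0) :
    ∑' v : {v : ℤ × ℤ // Int.gcd v.1 v.2 = 1}, g v =
      ∑' d : ℕ, (ArithmeticFunction.moebius d : ℝ) * ∑' w : ℤ × ℤ, g (d • w) := by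
  classical
  set S := hg.toFinset with hS
  have hout : ∀ v ∉ S, g v = 0 := by simp [hS]
  have hmul : ∀ d : ℕ, (ArithmeticFunction.moebius d : ℝ) * ∑' w : ℤ × ℤ, g (d • w) =
      ∑ v ∈ S, if d ∈ (Int.gcd v.1 v.2).divisors then
        (ArithmeticFunction.moebius d : ℝ) * g v else 0 := by
    intro d
    rcases Nat.eq_zero_or_pos d with rfl | hd
    · simp
    have hinj : Function.Injective (fun w : ℤ × ℤ => d • w) := fun a b h => by
      have hd' : (d : ℤ) ≠ 0 := by exact_mod_cast hd.ne'
      simp only [Prod.ext_iff, nsmul_eq_mul] at h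
      exact Prod.ext (mul_left_cancel₀ hd' h.1) (mul_left_cancel₀ hd' h.2)
    have hdvd (v : ℤ × ℤ) : d ∣ Int.gcd v.1 v.2 ↔ v ∈ Set.range (fun w : ℤ × ℤ => d • w) := by
      rw [← Int.natCast_dvd_natCast, Int.dvd_coe_gcd_iff]
      constructor
      · rintro ⟨⟨a, ha⟩, ⟨b, hb⟩⟩
        exact ⟨(a, b), by ext <;> simp [ha, hb]⟩
      · rintro ⟨w, rfl⟩
        simp
    have hsum : ∑' w : ℤ × ℤ, g (d • w) =
        ∑' v : ℤ × ℤ, if d ∣ Int.gcd v.1 v.2 then g v else 0 := by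
      rw [← hinj.tsum_eq (f := fun v : ℤ × ℤ => if d ∣ Int.gcd v.1 v.2 then g v else 0)]
      · refine tsum_congr fun w => (if_pos ((hdvd _).2 ⟨w, rfl⟩)).symm
      · intro v hv
        by_contra h
        exact hv (if_neg (fun h' => h ((hdvd v).1 h')))
    rw [hsum, tsum_eq_sum (s := S) (fun v hv => by simp [hout v hv]), Finset.mul_sum]
    refine Finset.sum_congr rfl fun v hv => ?_
    have hv0 : v ≠ 0 := by
      rintro rfl
      simp [hS, h0] at hv
    have hgcd : Int.gcd v.1 v.2 ≠ 0 := fun h => hv0 <| by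
      rw [Int.gcd_eq_zero_iff] at h
      exact Prod.ext h.1 h.2
    simp [hgcd]
  simp_rw [hmul]
  rw [Summable.tsum_finsetSum]
  · have hdiv : ∀ v : ℤ × ℤ, (∑' d : ℕ, if d ∈ (Int.gcd v.1 v.2).divisors then
        (ArithmeticFunction.moebius d : ℝ) * g v else 0) =
        if Int.gcd v.1 v.2 = 1 then g v else 0 := by
      intro v
      rw [tsum_eq_sum (s := (Int.gcd v.1 v.2).divisors) (fun d hd => if_neg hd),
        Finset.sum_congr rfl (fun d hd => if_pos hd), ← Finset.sum_mul, sum_divisors_moebius]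
      simp
    rw [Finset.sum_congr rfl fun v _ => hdiv v, ← tsum_eq_sum (s := S) (L := .unconditional _)
      (f := fun v : ℤ × ℤ => if Int.gcd v.1 v.2 = 1 then g v else 0)
      (fun v hv => by simp [hout v hv])]
    refine (tsum_subtype {v : ℤ × ℤ | Int.gcd v.1 v.2 = 1} g).trans (tsum_congr fun v => ?_)
    simp [Set.indicator_apply]
  · intro v _
    exact summable_of_hasFiniteSupport ((Int.gcd v.1 v.2).divisors.finite_toSet.subset
      fun d hd => by
        by_contra h
        exact hd (if_neg h))

/-- The restriction of `x ↦ f (x / L)` to the nonzero points of `ℤ²`. -/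
noncomputable def latticeSample (f : ℝ × ℝ → ℝ) (L : ℝ) (v : ℤ × ℤ) : ℝ :=
  if v = 0 then 0 else f ((v.1 : ℝ) / L, (v.2 : ℝ) / L)

lemma abs_floor_sub_div_le {L : ℝ} (hL : 0 < L) (x : ℝ) : |(⌊L * x⌋ : ℝ) / L - x| ≤ 1 / L := by
  have h1 := Int.floor_le (L * x)
  have h2 := Int.lt_floor_add_one (L * x)
  have : (⌊L * x⌋ : ℝ) / L - x = ((⌊L * x⌋ : ℝ) - L * x) / L := by field_simp
  rw [this, abs_div, abs_of_pos hL]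
  gcongr
  rw [abs_le]
  constructor <;> linarith

lemma norm_floor_sub_div_le {L : ℝ} (hL : 0 < L) (x : ℝ × ℝ) :
    ‖((⌊L * x.1⌋ : ℝ) / L, (⌊L * x.2⌋ : ℝ) / L) - x‖ ≤ 1 / L := by
  rw [Prod.norm_def]
  exact max_le (abs_floor_sub_div_le hL x.1) (abs_floor_sub_div_le hL x.2)

lemma inv_le_norm_div {L : ℝ} (hL : 0 < L) {v : ℤ × ℤ} (hv : v ≠ 0) :
    1 / L ≤ ‖((v.1 : ℝ) / L, (v.2 : ℝ) / L)‖ := by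
  have key : ∀ n : ℤ, n ≠ 0 → 1 / L ≤ ‖(n : ℝ) / L‖ := fun n hn => by
    rw [Real.norm_eq_abs, abs_div, abs_of_pos hL]
    gcongr
    exact_mod_cast Int.one_le_abs hn
  rw [Prod.norm_def, le_max_iff]
  by_cases h1 : v.1 = 0
  · exact Or.inr (key _ fun h2 => hv (Prod.ext h1 h2))
  · exact Or.inl (key _ h1)

lemma latticeSample_finite_support {f : ℝ × ℝ → ℝ} {R : ℝ} (hR : ∀ x, R < ‖x‖ → f x = 0)
    {L : ℝ} (hL : 0 < L) : (latticeSample f L).support.Finite := by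
  have hb : ∀ n : ℤ, |(n : ℝ) / L| ≤ R → n ∈ Set.Icc (-⌈R * L⌉) ⌈R * L⌉ := fun n hn => by
    rw [abs_div, abs_of_pos hL, div_le_iff₀ hL, abs_le] at hn
    have := Int.le_ceil (R * L)
    constructor
    · have : ((-⌈R * L⌉ : ℤ) : ℝ) ≤ n := by push_cast; linarith
      exact_mod_cast this
    · have : (n : ℝ) ≤ (⌈R * L⌉ : ℤ) := by linarith
      exact_mod_cast this
  refine ((Set.finite_Icc (-⌈R * L⌉) ⌈R * L⌉).prod
    (Set.finite_Icc (-⌈R * L⌉) ⌈R * L⌉)).subset fun v hv => ?_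
  have hle : ‖((v.1 : ℝ) / L, (v.2 : ℝ) / L)‖ ≤ R := by
    by_contra! h
    exact hv (by simp [latticeSample, hR _ h])
  exact ⟨hb _ ((norm_fst_le _).trans hle), hb _ ((norm_snd_le _).trans hle)⟩

lemma tsum_latticeSample_div_sq {f : ℝ × ℝ → ℝ} {R : ℝ} (hR : ∀ x, R < ‖x‖ → f x = 0)
    {L : ℝ} (hL : 0 < L) :
    (∑' v, latticeSample f L v) / L ^ 2 =
      ∫ x : ℝ × ℝ, latticeSample f L (⌊L * x.1⌋, ⌊L * x.2⌋) := by
  have h := Measure.integral_comp_smul (volume : Measure (ℝ × ℝ))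
    (fun x => latticeSample f L (⌊x.1⌋, ⌊x.2⌋)) L
  simp only [Prod.smul_fst, Prod.smul_snd, smul_eq_mul] at h
  rw [h, integral_comp_floor_prod (latticeSample_finite_support hR hL)]
  simp [abs_of_pos hL, div_eq_inv_mul]

lemma norm_latticeSample_floor_le {f : ℝ × ℝ → ℝ} {R M : ℝ} (hR : ∀ x, R < ‖x‖ → f x = 0)
    (hM : ∀ x, ‖f x‖ ≤ M) {L : ℝ} (hL : 0 < L) (x : ℝ × ℝ) :
    ‖latticeSample f L (⌊L * x.1⌋, ⌊L * x.2⌋)‖ ≤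
      (Metric.closedBall (0 : ℝ × ℝ) (2 * R)).indicator (fun _ => M) x := by
  have hM0 : 0 ≤ M := (norm_nonneg _).trans (hM 0)
  have hnn : 0 ≤ (Metric.closedBall (0 : ℝ × ℝ) (2 * R)).indicator (fun _ => M) x :=
    Set.indicator_nonneg (fun _ _ => hM0) x
  by_cases hv : ((⌊L * x.1⌋, ⌊L * x.2⌋) : ℤ × ℤ) = 0
  · simpa [latticeSample, hv] using hnn
  rw [latticeSample, if_neg hv]
  have h1 := inv_le_norm_div hL hv
  have h2 := norm_floor_sub_div_le hL x
  set y : ℝ × ℝ := ((⌊L * x.1⌋ : ℝ) / L, (⌊L * x.2⌋ : ℝ) / L)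
  by_cases hy : R < ‖y‖
  · simpa [hR y hy] using hnn
  · have hx : x ∈ Metric.closedBall (0 : ℝ × ℝ) (2 * R) := by
      rw [mem_closedBall_zero_iff]
      have := norm_sub_norm_le x y
      rw [norm_sub_rev] at this
      linarith [not_lt.1 hy]
    rw [Set.indicator_of_mem hx]
    exact hM y

lemma integrable_indicator_closedBall_const (r M : ℝ) :
    Integrable ((Metric.closedBall (0 : ℝ × ℝ) r).indicator (fun _ => M)) :=
  (integrable_indicator_iff Metric.isClosed_closedBall.measurableSet).2
    (integrableOn_const (isCompact_closedBall _ _).measure_lt_top.ne)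

lemma tendsto_tsum_latticeSample_div_sq {f : ℝ × ℝ → ℝ} (hf : Continuous f) {R M : ℝ}
    (hR : ∀ x, R < ‖x‖ → f x = 0) (hM : ∀ x, ‖f x‖ ≤ M) :
    Tendsto (fun L : ℝ => (∑' v, latticeSample f L v) / L ^ 2) atTop (nhds (∫ x, f x)) := by
  have hpos : ∀ᶠ L : ℝ in atTop, 0 < L := eventually_gt_atTop 0
  refine Tendsto.congr' (f₁ := fun L : ℝ =>
    ∫ x : ℝ × ℝ, latticeSample f L (⌊L * x.1⌋, ⌊L * x.2⌋)) ?_ ?_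
  · filter_upwards [hpos] with L hL using (tsum_latticeSample_div_sq hR hL).symm
  refine tendsto_integral_filter_of_dominated_convergence
    ((Metric.closedBall (0 : ℝ × ℝ) (2 * R)).indicator (fun _ => M)) ?_ ?_
    (integrable_indicator_closedBall_const _ _) ?_
  · refine Eventually.of_forall fun L => Measurable.aestronglyMeasurable ?_
    exact (measurable_of_countable (latticeSample f L)).comp (by fun_prop)
  · filter_upwards [hpos] with L hL
    exact Eventually.of_forall (norm_latticeSample_floor_le hR hM hL)
  · have hne : ∀ᵐ x : ℝ × ℝ, x ≠ 0 := by
      simp [ae_iff]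
    filter_upwards [hne] with x hx
    have hlim : Tendsto (fun L : ℝ => (((⌊L * x.1⌋ : ℝ) / L, (⌊L * x.2⌋ : ℝ) / L) : ℝ × ℝ))
        atTop (nhds x) := by
      rw [tendsto_iff_norm_sub_tendsto_zero]
      refine squeeze_zero' (Eventually.of_forall fun _ => norm_nonneg _) ?_
        (tendsto_const_nhds.div_atTop tendsto_id : Tendsto (fun L : ℝ => 1 / L) atTop (nhds 0))
      filter_upwards [hpos] with L hL using norm_floor_sub_div_le hL x
    refine ((hf.tendsto x).comp hlim).congr' ?_
    filter_upwards [hlim.eventually_ne hx] with L hL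
    rw [latticeSample, if_neg]
    · rfl
    · intro h
      rw [Prod.ext_iff] at h
      dsimp only [Prod.fst_zero, Prod.snd_zero] at h
      exact hL (by simp [h.1, h.2])

lemma exists_abs_tsum_latticeSample_div_sq_le {f : ℝ × ℝ → ℝ} {R M : ℝ}
    (hR : ∀ x, R < ‖x‖ → f x = 0) (hM : ∀ x, ‖f x‖ ≤ M) :
    ∃ C, ∀ L : ℝ, 0 < L → ‖(∑' v, latticeSample f L v) / L ^ 2‖ ≤ C := by
  refine ⟨∫ x,
    (Metric.closedBall (0 : ℝ × ℝ) (2 * R)).indicator (fun _ => M) x, fun L hL => ?_⟩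
  rw [tsum_latticeSample_div_sq hR hL]
  exact norm_integral_le_of_norm_le (integrable_indicator_closedBall_const _ _)
    (Eventually.of_forall (norm_latticeSample_floor_le hR hM hL))

lemma tsum_primitive_div_sq {f : ℝ × ℝ → ℝ} {R : ℝ} (hR : ∀ x, R < ‖x‖ → f x = 0)
    {L : ℝ} (hL : 0 < L) :
    (1 / L ^ 2) * ∑' v : {v : ℤ × ℤ // Int.gcd v.1 v.2 = 1},
        f (((v : ℤ × ℤ).1 : ℝ) / L, ((v : ℤ × ℤ).2 : ℝ) / L) =
      ∑' d : ℕ, (ArithmeticFunction.moebius d : ℝ) / d ^ 2 *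
        ((∑' v, latticeSample f (L / d) v) / (L / d) ^ 2) := by
  have h1 : ∀ v : {v : ℤ × ℤ // Int.gcd v.1 v.2 = 1},
      f (((v : ℤ × ℤ).1 : ℝ) / L, ((v : ℤ × ℤ).2 : ℝ) / L) = latticeSample f L v := by
    rintro ⟨v, hv⟩
    rw [latticeSample, if_neg]
    rintro rfl
    simp at hv
  rw [tsum_congr h1, tsum_primitive_eq_tsum_moebius (latticeSample_finite_support hR hL)
    (by simp [latticeSample]), ← tsum_mul_left]
  refine tsum_congr fun d => ?_
  rcases Nat.eq_zero_or_pos d with rfl | hd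
  · simp
  have h2 : ∀ w : ℤ × ℤ, latticeSample f L (d • w) = latticeSample f (L / d) w := fun w => by
    by_cases hw : w = 0
    · simp [latticeSample, hw]
    · have : d • w ≠ 0 := smul_ne_zero hd.ne' hw
      simp only [latticeSample, if_neg hw, if_neg this]
      congr 2 <;> · simp; field_simp
  rw [tsum_congr h2]
  have hd' : (d : ℝ) ≠ 0 := by exact_mod_cast hd.ne'
  field_simp

/-- The primitive points of `ℤ²` have density `∑ μ(d) / d²`. -/
lemma tendsto_tsum_primitive_div_sq {f : ℝ × ℝ → ℝ} (hf : Continuous f)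
    (hfc : HasCompactSupport f) :
    Tendsto (fun L : ℝ => (1 / L ^ 2) * ∑' v : {v : ℤ × ℤ // Int.gcd v.1 v.2 = 1},
        f (((v : ℤ × ℤ).1 : ℝ) / L, ((v : ℤ × ℤ).2 : ℝ) / L)) atTop
      (nhds ((∑' d : ℕ, (ArithmeticFunction.moebius d : ℝ) / d ^ 2) * ∫ x, f x)) := by
  obtain ⟨M, hM⟩ := hfc.exists_bound_of_continuous hf
  obtain ⟨R, hR⟩ : ∃ R, ∀ x, R < ‖x‖ → f x = 0 := by
    obtain ⟨R, hR⟩ := hfc.isBounded.exists_norm_le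
    refine ⟨R, fun x hx => ?_⟩
    by_contra h
    exact hx.not_ge (hR x (subset_tsupport f h))
  obtain ⟨C, hC⟩ := exists_abs_tsum_latticeSample_div_sq_le hR hM
  rw [← tsum_mul_right]
  refine Tendsto.congr' (f₁ := fun L : ℝ => ∑' d : ℕ,
    (ArithmeticFunction.moebius d : ℝ) / d ^ 2 *
        ((∑' v, latticeSample f (L / d) v) / (L / d) ^ 2)) ?_ ?_
  · filter_upwards [eventually_gt_atTop 0] with L hL using (tsum_primitive_div_sq hR hL).symm
  refine tendsto_tsum_of_dominated_convergence (bound := fun d : ℕ => 1 / (d : ℝ) ^ 2 * C)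
    ((Real.summable_one_div_nat_pow.2 one_lt_two).mul_right C) ?_ ?_
  · intro d
    rcases Nat.eq_zero_or_pos d with rfl | hd
    · simp
    · exact ((tendsto_tsum_latticeSample_div_sq hf hR hM).comp
        (tendsto_id.atTop_div_const (by exact_mod_cast hd))).const_mul _
  · filter_upwards [eventually_gt_atTop 0] with L hL d
    rcases Nat.eq_zero_or_pos d with rfl | hd
    · simp
    · rw [norm_mul]
      gcongr
      · rw [norm_div, norm_pow, Real.norm_natCast]
        gcongr
        rw [Real.norm_eq_abs]
        exact_mod_cast ArithmeticFunction.abs_moebius_le_one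
      · exact hC _ (by positivity)

/-- **Limit points of the primitive counting measures are multiples of Lebesgue measure.**
If `μ'` is a weak-⋆ limit point along a sequence `L_k → ∞` of the rescaled primitive
counting measures `ν_L^prim := L⁻² Σ_{v primitive} δ_{v/L}` on `ℝ²`, then `μ' = c · λ`
for some constant `c ≥ 0`, where `λ` is the Lebesgue measure. -/
theorem limit_point_of_primitive_counting_measures_is_multiple_of_lebesgue
    (L : ℕ → ℝ) (hLpos : ∀ k, 0 < L k) (hLtop : Tendsto L atTop atTop)
    (μ' : Measure (ℝ × ℝ)) [IsLocallyFiniteMeasure μ']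
    (hconv : ∀ f : ℝ × ℝ → ℝ, Continuous f → HasCompactSupport f →
      Tendsto (fun k : ℕ =>
          (1 / (L k) ^ 2) * ∑' v : {v : ℤ × ℤ // Int.gcd v.1 v.2 = 1},
            f (((v : ℤ × ℤ).1 : ℝ) / L k, ((v : ℤ × ℤ).2 : ℝ) / L k))
        atTop (nhds (∫ x, f x ∂μ'))) :
    ∃ c : ℝ≥0, μ' = c • (volume : Measure (ℝ × ℝ)) := by
  set c : ℝ := ∑' d : ℕ, (ArithmeticFunction.moebius d : ℝ) / d ^ 2
  have key : ∀ f : ℝ × ℝ → ℝ, Continuous f → HasCompactSupport f →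
      ∫ x, f x ∂μ' = c * ∫ x, f x := fun f hf hfc =>
    tendsto_nhds_unique (hconv f hf hfc) ((tendsto_tsum_primitive_div_sq hf hfc).comp hLtop)
  have hc : 0 ≤ c := by
    obtain ⟨f, hfc, hf0, hf⟩ := exists_continuous_nonneg_pos (0 : ℝ × ℝ)
    have hpos : 0 < ∫ x, f x :=
      f.continuous.integral_pos_of_hasCompactSupport_nonneg_nonzero hfc hf0 hf
    refine nonneg_of_mul_nonneg_left ?_ hpos
    rw [← key f f.continuous hfc]
    exact integral_nonneg hf0
  lift c to ℝ≥0 using hc with c'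
  have : (c' • (volume : Measure (ℝ × ℝ))).Regular := Measure.Regular.smul_nnreal c'
  refine ⟨c', Measure.ext_of_integral_eq_on_compactlySupported fun f => ?_⟩
  rw [key f f.continuous f.hasCompactSupport, integral_smul_nnreal_measure]
  rfl
end
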